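/- arXiv:2310.20660 — 3 statements merged into one kernel-verified Lean document; each statement's English description precedes it below -/
import Mathlib

section
/- Let (𝔤, g, J_g, E_g) and (𝔥, h, J_h, E_h) be hypersymplectic Lie algebras and let φ : 𝔥 → Der(𝔤) be a Lie algebra homomorphism such that for every A ∈ 𝔥 the map φ(A) is g-antisymmetric (φ(A)^s = 0) and commutes with both J_g and E_g. Then 𝔤 ⋊_φ 𝔥 with the product structures g̃, J̃ and Ẽ(X+A) = E_g X + E_h A is a hypersymplectic Lie algebra. -/
open Module

/-- A pseudo-Kähler Lie algebra structure. -/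
def IsPseudoKahler (L : Type*) [LieRing L] [LieAlgebra ℝ L] [FiniteDimensional ℝ L]
    (g : L →ₗ[ℝ] L →ₗ[ℝ] ℝ) (J : Module.End ℝ L) : Prop :=
  (∀ x y, g x y = g y x) ∧
  (∀ x, (∀ y, g x y = 0) → x = 0) ∧
  (J ∘ₗ J = -1) ∧
  (∀ x y, g (J x) (J y) = g x y) ∧
  ∀ lc : L →ₗ[ℝ] L →ₗ[ℝ] L,
    (∀ x y z, 2 * g (lc x y) z = g ⁅x, y⁆ z - g y ⁅x, z⁆ - g x ⁅y, z⁆) →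
    ∀ x y, lc x (J y) = J (lc x y)

/-- A hypersymplectic Lie algebra structure: a pseudo-Kähler structure `(g, J)`
together with a compatible parallel almost para-complex structure `E`. -/
def IsHypersymplectic (L : Type*) [LieRing L] [LieAlgebra ℝ L] [FiniteDimensional ℝ L]
    (g : L →ₗ[ℝ] L →ₗ[ℝ] ℝ) (J E : Module.End ℝ L) : Prop :=
  IsPseudoKahler L g J ∧
  (E ∘ₗ E = 1) ∧
  (J ∘ₗ E = -(E ∘ₗ J)) ∧
  (∀ x y, g (E x) (E y) = -(g x y)) ∧
  ∀ lc : L →ₗ[ℝ] L →ₗ[ℝ] L,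
    (∀ x y z, 2 * g (lc x y) z = g ⁅x, y⁆ z - g y ⁅x, z⁆ - g x ⁅y, z⁆) →
    ∀ x y, lc x (E y) = E (lc x y)

/-- The Koszul form `2 g(∇_x y, z)` of a bilinear form on a Lie algebra. -/
def koszulForm {L : Type*} [LieRing L] [LieAlgebra ℝ L]
    (g : L →ₗ[ℝ] L →ₗ[ℝ] ℝ) (x y z : L) : ℝ :=
  g ⁅x, y⁆ z - g y ⁅x, z⁆ - g x ⁅y, z⁆

/-- The Levi-Civita product of a nondegenerate form exists. -/
lemma exists_leviCivita {L : Type*} [LieRing L] [LieAlgebra ℝ L] [FiniteDimensional ℝ L]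
    {g : L →ₗ[ℝ] L →ₗ[ℝ] ℝ} (hnd : ∀ x, (∀ y, g x y = 0) → x = 0) :
    ∃ lc : L →ₗ[ℝ] L →ₗ[ℝ] L, ∀ x y z, 2 * g (lc x y) z = koszulForm g x y z := by
  have hinj : Function.Injective g :=
    (injective_iff_map_eq_zero g).2 fun x hx => hnd x fun y => by simp [hx]
  let e : L ≃ₗ[ℝ] (L →ₗ[ℝ] ℝ) :=
    LinearEquiv.ofInjectiveOfFinrankEq g hinj (Subspace.dual_finrank_eq (K := ℝ) (V := L)).symm
  have he : ∀ f z, g (e.symm f) z = f z := fun f z =>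
    DFunLike.congr_fun (e.apply_symm_apply f) z
  let k : L →ₗ[ℝ] L →ₗ[ℝ] L →ₗ[ℝ] ℝ := LinearMap.mk₂ ℝ
    (fun x y => g ⁅x, y⁆ - g y ∘ₗ LieAlgebra.ad ℝ L x - g x ∘ₗ LieAlgebra.ad ℝ L y)
    (fun _ _ _ => by ext; simp; ring) (fun _ _ _ => by ext; simp; ring)
    (fun _ _ _ => by ext; simp; ring) (fun _ _ _ => by ext; simp; ring)
  refine ⟨((2 : ℝ)⁻¹ • k).compr₂ e.symm.toLinearMap, fun x y z => ?_⟩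
  simp [he, k, koszulForm]

/-- A `g`-skew endomorphism is parallel for every Levi-Civita product of `g` if and only if
it is skew in the last two arguments of the Koszul form. -/
lemma parallel_iff_koszulForm {L : Type*} [LieRing L] [LieAlgebra ℝ L] [FiniteDimensional ℝ L]
    {g : L →ₗ[ℝ] L →ₗ[ℝ] ℝ} (hnd : ∀ x, (∀ y, g x y = 0) → x = 0)
    {T : Module.End ℝ L} (hT : ∀ x y, g (T x) y = -g x (T y)) :
    (∀ lc : L →ₗ[ℝ] L →ₗ[ℝ] L,
      (∀ x y z, 2 * g (lc x y) z = g ⁅x, y⁆ z - g y ⁅x, z⁆ - g x ⁅y, z⁆) →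
      ∀ x y, lc x (T y) = T (lc x y)) ↔
    ∀ x y z, koszulForm g x (T y) z = -koszulForm g x y (T z) := by
  constructor
  · intro H x y z
    obtain ⟨lc, hlc⟩ := exists_leviCivita hnd
    rw [← hlc, ← hlc, H lc hlc, hT]
    ring
  · intro H lc hlc x y
    refine sub_eq_zero.1 (hnd _ fun z => ?_)
    have h₁ : 2 * g (lc x (T y)) z = koszulForm g x (T y) z := hlc x (T y) z
    have h₂ : 2 * g (lc x y) (T z) = koszulForm g x y (T z) := hlc x y (T z)
    rw [map_sub, LinearMap.sub_apply, hT]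
    linarith [H x y z]

lemma skew_of_isometry {V : Type*} [AddCommGroup V] [Module ℝ V]
    {g : V →ₗ[ℝ] V →ₗ[ℝ] ℝ} {J : Module.End ℝ V}
    (hJ : J ∘ₗ J = -1) (hg : ∀ x y, g (J x) (J y) = g x y) (x y : V) :
    g (J x) y = -g x (J y) := by
  have hy : J (J y) = -y := DFunLike.congr_fun hJ y
  rw [← hg x (J y), hy, map_neg, neg_neg]

lemma skew_of_antiIsometry {V : Type*} [AddCommGroup V] [Module ℝ V]
    {g : V →ₗ[ℝ] V →ₗ[ℝ] ℝ} {E : Module.End ℝ V}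
    (hE : E ∘ₗ E = 1) (hg : ∀ x y, g (E x) (E y) = -g x y) (x y : V) :
    g (E x) y = -g x (E y) := by
  have hy : E (E y) = y := DFunLike.congr_fun hE y
  rw [← hg x (E y), hy]

/-- a semidirect product of hypersymplectic Lie algebras along a
representation by g-antisymmetric derivations commuting with `J_g` and `E_g` is
hypersymplectic. -/
theorem stmt_16
    (𝔤 𝔥 G : Type*)
    [LieRing 𝔤] [LieAlgebra ℝ 𝔤] [FiniteDimensional ℝ 𝔤]
    [LieRing 𝔥] [LieAlgebra ℝ 𝔥] [FiniteDimensional ℝ 𝔥]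
    [LieRing G] [LieAlgebra ℝ G] [FiniteDimensional ℝ G]
    (g : 𝔤 →ₗ[ℝ] 𝔤 →ₗ[ℝ] ℝ) (Jg Eg : Module.End ℝ 𝔤)
    (h : 𝔥 →ₗ[ℝ] 𝔥 →ₗ[ℝ] ℝ) (Jh Eh : Module.End ℝ 𝔥)
    (hhsg : IsHypersymplectic 𝔤 g Jg Eg) (hhsh : IsHypersymplectic 𝔥 h Jh Eh)
    -- φ : 𝔥 → Der(𝔤), a Lie algebra homomorphism into the derivations of 𝔤
    (φ : 𝔥 →ₗ[ℝ] Module.End ℝ 𝔤)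
    (hder : ∀ a x y, φ a ⁅x, y⁆ = ⁅φ a x, y⁆ + ⁅x, φ a y⁆)
    (hhom : ∀ a b, φ ⁅a, b⁆ = φ a ∘ₗ φ b - φ b ∘ₗ φ a)
    -- each φ(A) is g-antisymmetric and commutes with J_g and E_g
    (hskew : ∀ a x y, g (φ a x) y = -(g x (φ a y)))
    (hφJ : ∀ a, φ a ∘ₗ Jg = Jg ∘ₗ φ a)
    (hφE : ∀ a, φ a ∘ₗ Eg = Eg ∘ₗ φ a)
    -- G is the semidirect product 𝔤 ⋊_φ 𝔥, presented through i, p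
    (i : 𝔤 →ₗ[ℝ] G) (p : 𝔥 →ₗ[ℝ] G)
    (hbij : Function.Bijective fun q : 𝔤 × 𝔥 => i q.1 + p q.2)
    (hbrk : ∀ x a y b, ⁅i x + p a, i y + p b⁆
      = i ⁅x, y⁆ + i (φ a y) - i (φ b x) + p ⁅a, b⁆)
    -- the product structures
    (gt : G →ₗ[ℝ] G →ₗ[ℝ] ℝ)
    (hgt : ∀ x a y b, gt (i x + p a) (i y + p b) = g x y + h a b)
    (Jt : Module.End ℝ G)
    (hJt : ∀ x a, Jt (i x + p a) = i (Jg x) + p (Jh a))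
    (Et : Module.End ℝ G)
    (hEt : ∀ x a, Et (i x + p a) = i (Eg x) + p (Eh a)) :
    IsHypersymplectic G gt Jt Et := by
  obtain ⟨⟨gsymm, gnd, gJ, gJJ, gJpar⟩, gE, gJE, gEE, gEpar⟩ := hhsg
  obtain ⟨⟨hsymm, hnd, hJ, hJJ, hJpar⟩, hE, hJE, hEE, hEpar⟩ := hhsh
  have hsurj : ∀ u : G, ∃ x a, u = i x + p a := fun u => by
    obtain ⟨q, hq⟩ := hbij.2 u
    exact ⟨q.1, q.2, hq.symm⟩
  have gtnd : ∀ u, (∀ v, gt u v = 0) → u = 0 := by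
    intro u hu
    obtain ⟨x, a, rfl⟩ := hsurj u
    have hx : x = 0 := gnd x fun y => by
      have := hu (i y + p 0)
      rw [hgt] at this
      simpa using this
    have ha : a = 0 := hnd a fun b => by
      have := hu (i 0 + p b)
      rw [hgt] at this
      simpa using this
    simp [hx, ha]
  have hkoszul : ∀ x a y b z c, koszulForm gt (i x + p a) (i y + p b) (i z + p c)
      = koszulForm g x y z + koszulForm h a b c + 2 * g (φ a y) z := by
    intro x a y b z c
    simp only [koszulForm, hbrk, ← map_add, ← map_sub, hgt]
    simp only [map_add, map_sub, LinearMap.add_apply, LinearMap.sub_apply]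
    linarith [hskew a y z, hskew b x z, hskew c x y, gsymm (φ c x) y]
  have hskewKoszul : ∀ (T : Module.End ℝ G) (Tg : Module.End ℝ 𝔤) (Th : Module.End ℝ 𝔥),
      (∀ x a, T (i x + p a) = i (Tg x) + p (Th a)) →
      (∀ a, φ a ∘ₗ Tg = Tg ∘ₗ φ a) →
      (∀ x y, g (Tg x) y = -g x (Tg y)) →
      (∀ x y z, koszulForm g x (Tg y) z = -koszulForm g x y (Tg z)) →
      (∀ x y z, koszulForm h x (Th y) z = -koszulForm h x y (Th z)) →
      ∀ u v w, koszulForm gt u (T v) w = -koszulForm gt u v (T w) := by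
    intro T Tg Th hT hcomm hTg hKg hKh u v w
    obtain ⟨x, a, rfl⟩ := hsurj u
    obtain ⟨y, b, rfl⟩ := hsurj v
    obtain ⟨z, c, rfl⟩ := hsurj w
    have hc : φ a (Tg y) = Tg (φ a y) := DFunLike.congr_fun (hcomm a) y
    rw [hT, hT, hkoszul, hkoszul, hKg, hKh, hc, hTg]
    ring
  have gtJ : Jt ∘ₗ Jt = -1 := by
    ext u
    obtain ⟨x, a, rfl⟩ := hsurj u
    have h₁ : Jg (Jg x) = -x := DFunLike.congr_fun gJ x
    have h₂ : Jh (Jh a) = -a := DFunLike.congr_fun hJ a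
    simp only [LinearMap.comp_apply, hJt, h₁, h₂, LinearMap.neg_apply, Module.End.one_apply,
      map_neg]
    abel
  have gtE : Et ∘ₗ Et = 1 := by
    ext u
    obtain ⟨x, a, rfl⟩ := hsurj u
    have h₁ : Eg (Eg x) = x := DFunLike.congr_fun gE x
    have h₂ : Eh (Eh a) = a := DFunLike.congr_fun hE a
    simp only [LinearMap.comp_apply, hEt, h₁, h₂, Module.End.one_apply]
  have gtJJ : ∀ u v, gt (Jt u) (Jt v) = gt u v := by
    intro u v
    obtain ⟨x, a, rfl⟩ := hsurj u
    obtain ⟨y, b, rfl⟩ := hsurj v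
    rw [hJt, hJt, hgt, hgt, gJJ, hJJ]
  have gtEE : ∀ u v, gt (Et u) (Et v) = -gt u v := by
    intro u v
    obtain ⟨x, a, rfl⟩ := hsurj u
    obtain ⟨y, b, rfl⟩ := hsurj v
    rw [hEt, hEt, hgt, hgt, gEE, hEE]
    ring
  have gJskew := skew_of_isometry gJ gJJ
  have gEskew := skew_of_antiIsometry gE gEE
  refine ⟨⟨?_, gtnd, gtJ, gtJJ, ?_⟩, gtE, ?_, gtEE, ?_⟩
  · intro u v
    obtain ⟨x, a, rfl⟩ := hsurj u
    obtain ⟨y, b, rfl⟩ := hsurj v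
    rw [hgt, hgt, gsymm, hsymm]
  · exact (parallel_iff_koszulForm gtnd (skew_of_isometry gtJ gtJJ)).2
      (hskewKoszul Jt Jg Jh hJt hφJ gJskew ((parallel_iff_koszulForm gnd gJskew).1 gJpar)
        ((parallel_iff_koszulForm hnd (skew_of_isometry hJ hJJ)).1 hJpar))
  · ext u
    obtain ⟨x, a, rfl⟩ := hsurj u
    have h₁ : Jg (Eg x) = -Eg (Jg x) := DFunLike.congr_fun gJE x
    have h₂ : Jh (Eh a) = -Eh (Jh a) := DFunLike.congr_fun hJE a
    simp only [LinearMap.comp_apply, LinearMap.neg_apply, hEt, hJt, h₁, h₂, map_neg]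
    abel
  · exact (parallel_iff_koszulForm gtnd (skew_of_antiIsometry gtE gtEE)).2
      (hskewKoszul Et Eg Eh hEt hφE gEskew ((parallel_iff_koszulForm gnd gEskew).1 gEpar)
        ((parallel_iff_koszulForm hnd (skew_of_antiIsometry hE hEE)).1 hEpar))
end

section
/- For every natural number n ≥ 2 there exists a real Lie algebra L of dimension 4n such that: L is 2-step nilpotent (i.e. [L,[L,L]] = 0 and [L,L] ≠ 0); L admits a hypersymplectic structure; for every hypersymplectic structure (g, J, E) on L the complex structure J is not abelian, i.e. there exist X, Y ∈ L with [JX, JY] ≠ [X, Y]; and no hypersymplectic structure (g, J, E) on L is of Kodaira type, i.e. for no such structure is the center of L both J-invariant and of dimension 2n. -/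
open Module

/-- The properties required of the Lie algebra `L` in STATEMENT 17. -/
def GoodHSAlgebra (n : ℕ) (L : Type) [LieRing L] [LieAlgebra ℝ L]
    [FiniteDimensional ℝ L] : Prop :=
  Module.finrank ℝ L = 4 * n
  -- L is 2-step nilpotent
  ∧ (∀ u v w : L, ⁅u, ⁅v, w⁆⁆ = 0)
  ∧ (∃ u v : L, ⁅u, v⁆ ≠ 0)
  -- L admits a hypersymplectic structure
  ∧ (∃ (g : L →ₗ[ℝ] L →ₗ[ℝ] ℝ) (J E : Module.End ℝ L), IsHypersymplectic L g J E)
  -- for every hypersymplectic structure, J is not abelian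
  ∧ (∀ (g : L →ₗ[ℝ] L →ₗ[ℝ] ℝ) (J E : Module.End ℝ L),
      IsHypersymplectic L g J E → ∃ x y : L, ⁅J x, J y⁆ ≠ ⁅x, y⁆)
  -- no hypersymplectic structure on L is of Kodaira type
  ∧ (∀ (g : L →ₗ[ℝ] L →ₗ[ℝ] ℝ) (J E : Module.End ℝ L),
      IsHypersymplectic L g J E →
      ¬ ((∀ z ∈ LieAlgebra.center ℝ L, J z ∈ LieAlgebra.center ℝ L)
        ∧ Module.finrank ℝ ↥(LieAlgebra.center ℝ L) = 2 * n))

/-- The underlying space of `ℝ³ ⊕ 𝔥 ⊕ ℝ⁴ᵐ`, where `𝔥` is the five-dimensional Lie algebra with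
basis `a, f, f₂, e, e₂` and brackets `[a, f] = e`, `[a, f₂] = e₂`. An element is a family of
`m + 2` blocks of four coordinates; `e, f, e₂, f₂` span block `0` and `a` is the first basis
vector of block `1`. -/
def OddCenterAlgebra (m : ℕ) : Type := Fin (m + 2) → Fin 4 → ℝ

namespace OddCenterAlgebra

variable {m : ℕ}

noncomputable instance : AddCommGroup (OddCenterAlgebra m) :=
  inferInstanceAs (AddCommGroup (Fin (m + 2) → Fin 4 → ℝ))

noncomputable instance : Module ℝ (OddCenterAlgebra m) :=
  inferInstanceAs (Module ℝ (Fin (m + 2) → Fin 4 → ℝ))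

instance : FiniteDimensional ℝ (OddCenterAlgebra m) :=
  inferInstanceAs (FiniteDimensional ℝ (Fin (m + 2) → Fin 4 → ℝ))

/-- The coordinates of an element. -/
def coord (x : OddCenterAlgebra m) (i : Fin (m + 2)) (k : Fin 4) : ℝ := x i k

/-- The element with given coordinates. -/
def ofCoord (c : Fin (m + 2) → Fin 4 → ℝ) : OddCenterAlgebra m := c

@[simp] theorem coord_ofCoord (c : Fin (m + 2) → Fin 4 → ℝ) (i k) :
    (ofCoord c).coord i k = c i k := rfl

@[simp] theorem coord_add (x y : OddCenterAlgebra m) (i k) :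
    (x + y).coord i k = x.coord i k + y.coord i k := rfl

@[simp] theorem coord_neg (x : OddCenterAlgebra m) (i k) :
    (-x).coord i k = -x.coord i k := rfl

@[simp] theorem coord_smul (r : ℝ) (x : OddCenterAlgebra m) (i k) :
    (r • x).coord i k = r * x.coord i k := rfl

@[simp] theorem coord_zero (i k) : (0 : OddCenterAlgebra m).coord i k = 0 := rfl

@[ext] theorem ext {x y : OddCenterAlgebra m} (h : ∀ i k, x.coord i k = y.coord i k) : x = y :=
  funext fun i => funext fun k => h i k

theorem finrank_eq : finrank ℝ (OddCenterAlgebra m) = 4 * (m + 2) := by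
  have h : finrank ℝ (Fin (m + 2) → Fin 4 → ℝ) = 4 * (m + 2) := by
    simp [Module.finrank_pi_fintype, mul_comm]
  exact h

noncomputable instance : Bracket (OddCenterAlgebra m) (OddCenterAlgebra m) where
  bracket x y := ofCoord fun i =>
    if i = 0 then
      ![x.coord 1 0 * y.coord 0 1 - y.coord 1 0 * x.coord 0 1, 0,
        x.coord 1 0 * y.coord 0 3 - y.coord 1 0 * x.coord 0 3, 0]
    else 0

theorem coord_lie (x y : OddCenterAlgebra m) (i k) :
    ⁅x, y⁆.coord i k =
      (if i = 0 then
        ![x.coord 1 0 * y.coord 0 1 - y.coord 1 0 * x.coord 0 1, 0,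
          x.coord 1 0 * y.coord 0 3 - y.coord 1 0 * x.coord 0 3, 0]
      else 0 : Fin 4 → ℝ) k := rfl

noncomputable instance : LieRing (OddCenterAlgebra m) where
  add_lie x y z := by
    ext i k
    by_cases hi : i = 0 <;> fin_cases k <;> simp [coord_lie, hi] <;> ring
  lie_add x y z := by
    ext i k
    by_cases hi : i = 0 <;> fin_cases k <;> simp [coord_lie, hi] <;> ring
  lie_self x := by
    ext i k
    by_cases hi : i = 0 <;> fin_cases k <;> simp [coord_lie, hi]
  leibniz_lie x y z := by
    ext i k
    by_cases hi : i = 0 <;> fin_cases k <;> simp [coord_lie, hi]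

noncomputable instance : LieAlgebra ℝ (OddCenterAlgebra m) where
  lie_smul r x y := by
    ext i k
    by_cases hi : i = 0 <;> fin_cases k <;> simp [coord_lie, hi] <;> ring

theorem lie_lie_eq_zero (x y z : OddCenterAlgebra m) : ⁅x, ⁅y, z⁆⁆ = 0 := by
  ext i k
  by_cases hi : i = 0 <;> fin_cases k <;> simp [coord_lie, hi]

/-- The coordinates along `a`, `f` and `f₂`. -/
noncomputable def noncentralPart (m : ℕ) : OddCenterAlgebra m →ₗ[ℝ] Fin 3 → ℝ where
  toFun x := ![x.coord 1 0, x.coord 0 1, x.coord 0 3]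
  map_add' x y := by ext k; fin_cases k <;> simp
  map_smul' r x := by ext k; fin_cases k <;> simp

theorem noncentralPart_surjective : Function.Surjective (noncentralPart m) := by
  intro v
  refine ⟨ofCoord fun i => if i = 0 then ![0, v 1, 0, v 2] else ![v 0, 0, 0, 0], ?_⟩
  ext k
  fin_cases k <;> simp [noncentralPart]

theorem exists_lie_ne_zero : ∃ x y : OddCenterAlgebra m, ⁅x, y⁆ ≠ 0 := by
  obtain ⟨a, ha⟩ := noncentralPart_surjective (m := m) ![1, 0, 0]
  obtain ⟨f, hf⟩ := noncentralPart_surjective (m := m) ![0, 1, 0]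
  refine ⟨a, f, fun h => ?_⟩
  have h0 := congrArg (fun x => x.coord 0 0) h
  have ha0 := congrFun ha 0
  have ha1 := congrFun ha 1
  have hf1 := congrFun hf 1
  simp [noncentralPart] at ha0 ha1 hf1
  simp [coord_lie, ha0, ha1, hf1] at h0

theorem mem_center_iff (x : OddCenterAlgebra m) :
    x ∈ LieAlgebra.center ℝ (OddCenterAlgebra m) ↔ noncentralPart m x = 0 := by
  rw [LieModule.mem_maxTrivSubmodule]
  constructor
  · intro h
    obtain ⟨a, ha⟩ := noncentralPart_surjective (m := m) ![1, 0, 0]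
    obtain ⟨f, hf⟩ := noncentralPart_surjective (m := m) ![0, 1, 0]
    have ha0 := congrFun ha 0
    have ha1 := congrFun ha 1
    have ha2 := congrFun ha 2
    have hf0 := congrFun hf 0
    have hf1 := congrFun hf 1
    have h1 := congrArg (fun x => x.coord 0 0) (h a)
    have h2 := congrArg (fun x => x.coord 0 2) (h a)
    have h3 := congrArg (fun x => x.coord 0 0) (h f)
    simp [noncentralPart] at ha0 ha1 ha2 hf0 hf1
    simp [coord_lie, ha0, ha1, ha2, hf0, hf1] at h1 h2 h3
    ext k
    fin_cases k <;> simp [noncentralPart, h1, h2, h3]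
  · intro h y
    have h0 := congrFun h 0
    have h1 := congrFun h 1
    have h2 := congrFun h 2
    simp [noncentralPart] at h0 h1 h2
    ext i k
    by_cases hi : i = 0 <;> fin_cases k <;> simp [coord_lie, hi, h0, h1, h2]

theorem finrank_center :
    finrank ℝ (LieAlgebra.center ℝ (OddCenterAlgebra m)) = 4 * m + 5 := by
  have hc : (LieAlgebra.center ℝ (OddCenterAlgebra m)).toSubmodule =
      LinearMap.ker (noncentralPart m) := by
    ext x
    exact mem_center_iff x
  have hsum := (noncentralPart m).finrank_range_add_finrank_ker
  rw [LinearMap.range_eq_top.2 noncentralPart_surjective, finrank_top, finrank_eq,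
    finrank_fin_fun, ← hc] at hsum
  change finrank ℝ (LieAlgebra.center ℝ (OddCenterAlgebra m)).toSubmodule = _
  lia

/-- The neutral metric. -/
noncomputable def metric (m : ℕ) :
    OddCenterAlgebra m →ₗ[ℝ] OddCenterAlgebra m →ₗ[ℝ] ℝ :=
  LinearMap.mk₂ ℝ
    (fun x y => ∑ i, (x.coord i 0 * y.coord i 3 - x.coord i 1 * y.coord i 2
      + x.coord i 3 * y.coord i 0 - x.coord i 2 * y.coord i 1))
    (fun x x' y => by
      rw [← Finset.sum_add_distrib]
      exact Finset.sum_congr rfl fun i _ => by simp only [coord_add]; ring)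
    (fun r x y => by
      rw [smul_eq_mul, Finset.mul_sum]
      exact Finset.sum_congr rfl fun i _ => by simp only [coord_smul]; ring)
    (fun x y y' => by
      rw [← Finset.sum_add_distrib]
      exact Finset.sum_congr rfl fun i _ => by simp only [coord_add]; ring)
    (fun r x y => by
      rw [smul_eq_mul, Finset.mul_sum]
      exact Finset.sum_congr rfl fun i _ => by simp only [coord_smul]; ring)

theorem metric_apply (x y : OddCenterAlgebra m) :
    metric m x y = ∑ i, (x.coord i 0 * y.coord i 3 - x.coord i 1 * y.coord i 2
      + x.coord i 3 * y.coord i 0 - x.coord i 2 * y.coord i 1) := rfl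

theorem metric_comm (x y : OddCenterAlgebra m) : metric m x y = metric m y x := by
  simp only [metric_apply]
  exact Finset.sum_congr rfl fun i _ => by ring

theorem metric_lie_left (x y z : OddCenterAlgebra m) :
    metric m ⁅x, y⁆ z =
      (x.coord 1 0 * y.coord 0 1 - y.coord 1 0 * x.coord 0 1) * z.coord 0 3
        - (x.coord 1 0 * y.coord 0 3 - y.coord 1 0 * x.coord 0 3) * z.coord 0 1 := by
  rw [metric_apply, Finset.sum_eq_single 0]
  · simp [coord_lie]
  · intro i _ hi
    simp [coord_lie, hi]
  · simp

theorem eq_zero_of_metric_eq_zero (x : OddCenterAlgebra m) (h : ∀ y, metric m x y = 0) :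
    x = 0 := by
  have key (i : Fin (m + 2)) (v : Fin 4 → ℝ) :
      x.coord i 0 * v 3 - x.coord i 1 * v 2 + x.coord i 3 * v 0 - x.coord i 2 * v 1 = 0 := by
    have hi := h (ofCoord fun j => if j = i then v else 0)
    rw [metric_apply, Finset.sum_eq_single i] at hi
    · simpa using hi
    · intro j _ hj
      simp [hj]
    · simp
  ext i k
  fin_cases k
  · simpa using key i ![0, 0, 0, 1]
  · simpa using key i ![0, 0, 1, 0]
  · simpa using key i ![0, 1, 0, 0]
  · simpa using key i ![1, 0, 0, 0]

/-- The complex structure, exchanging the first two and the last two coordinates of each block. -/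
noncomputable def complexStructure (m : ℕ) : Module.End ℝ (OddCenterAlgebra m) where
  toFun x := ofCoord fun i => ![-x.coord i 2, -x.coord i 3, x.coord i 0, x.coord i 1]
  map_add' x y := by ext i k; fin_cases k <;> simp [add_comm]
  map_smul' r x := by ext i k; fin_cases k <;> simp

theorem coord_complexStructure (x : OddCenterAlgebra m) (i k) :
    (complexStructure m x).coord i k =
      ![-x.coord i 2, -x.coord i 3, x.coord i 0, x.coord i 1] k := rfl

/-- The product structure, whose eigenspaces are spanned by the first two and the last two
coordinate vectors of the blocks. -/
noncomputable def productStructure (m : ℕ) : Module.End ℝ (OddCenterAlgebra m) where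
  toFun x := ofCoord fun i => ![x.coord i 0, x.coord i 1, -x.coord i 2, -x.coord i 3]
  map_add' x y := by ext i k; fin_cases k <;> simp [add_comm]
  map_smul' r x := by ext i k; fin_cases k <;> simp

theorem coord_productStructure (x : OddCenterAlgebra m) (i k) :
    (productStructure m x).coord i k =
      ![x.coord i 0, x.coord i 1, -x.coord i 2, -x.coord i 3] k := rfl

/-- The Levi-Civita product of `metric m`. -/
noncomputable def leviCivita (x y : OddCenterAlgebra m) : OddCenterAlgebra m :=
  ofCoord fun i =>
    if i = 0 then ![x.coord 1 0 * y.coord 0 1, 0, x.coord 1 0 * y.coord 0 3, 0] else 0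

theorem metric_leviCivita (x y z : OddCenterAlgebra m) :
    metric m (leviCivita x y) z =
      x.coord 1 0 * y.coord 0 1 * z.coord 0 3 - x.coord 1 0 * y.coord 0 3 * z.coord 0 1 := by
  rw [metric_apply, Finset.sum_eq_single 0]
  · simp [leviCivita]
  · intro i _ hi
    simp [leviCivita, hi]
  · simp

theorem eq_leviCivita (lc : OddCenterAlgebra m →ₗ[ℝ] OddCenterAlgebra m →ₗ[ℝ] OddCenterAlgebra m)
    (h : ∀ x y z, 2 * metric m (lc x y) z =
      metric m ⁅x, y⁆ z - metric m y ⁅x, z⁆ - metric m x ⁅y, z⁆)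
    (x y : OddCenterAlgebra m) : lc x y = leviCivita x y := by
  rw [← sub_eq_zero]
  refine eq_zero_of_metric_eq_zero _ fun z => ?_
  have hz := h x y z
  rw [metric_comm y, metric_comm x, metric_lie_left, metric_lie_left, metric_lie_left] at hz
  rw [map_sub, LinearMap.sub_apply, metric_leviCivita]
  linarith

theorem isHypersymplectic :
    IsHypersymplectic (OddCenterAlgebra m) (metric m) (complexStructure m)
      (productStructure m) := by
  refine ⟨⟨metric_comm, eq_zero_of_metric_eq_zero, ?_, fun x y => ?_, fun lc h x y => ?_⟩,
    ?_, ?_, fun x y => ?_, fun lc h x y => ?_⟩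
  · ext x i k
    fin_cases k <;> simp [coord_complexStructure]
  · simp only [metric_apply]
    refine Finset.sum_congr rfl fun i _ => ?_
    simp [coord_complexStructure]
    ring
  · rw [eq_leviCivita lc h, eq_leviCivita lc h]
    ext i k
    by_cases hi : i = 0 <;> fin_cases k <;> simp [coord_complexStructure, leviCivita, hi]
  · ext x i k
    fin_cases k <;> simp [coord_productStructure]
  · ext x i k
    fin_cases k <;> simp [coord_complexStructure, coord_productStructure]
  · simp only [metric_apply, ← Finset.sum_neg_distrib]
    refine Finset.sum_congr rfl fun i _ => ?_
    simp [coord_productStructure]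
    ring
  · rw [eq_leviCivita lc h, eq_leviCivita lc h]
    ext i k
    by_cases hi : i = 0 <;> fin_cases k <;> simp [coord_productStructure, leviCivita, hi]

end OddCenterAlgebra

/-- A real vector space with a complex structure has even dimension. -/
theorem even_finrank_of_comp_self_eq_neg_one {V : Type*} [AddCommGroup V] [Module ℝ V]
    (J : Module.End ℝ V) (hJ : J ∘ₗ J = -1) : Even (finrank ℝ V) := by
  have h := congrArg LinearMap.det hJ
  rw [LinearMap.det_comp, ← neg_one_smul ℝ (1 : Module.End ℝ V), LinearMap.det_smul, map_one,
    mul_one] at h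
  by_contra hodd
  rw [Nat.not_even_iff_odd] at hodd
  rw [hodd.neg_one_pow] at h
  nlinarith [mul_self_nonneg (LinearMap.det J)]

/-- The center is invariant under an abelian complex structure. -/
theorem map_mem_center_of_abelian {L : Type*} [LieRing L] [LieAlgebra ℝ L]
    {J : Module.End ℝ L} (hJ : J ∘ₗ J = -1) (hab : ∀ x y : L, ⁅J x, J y⁆ = ⁅x, y⁆)
    {z : L} (hz : z ∈ LieAlgebra.center ℝ L) : J z ∈ LieAlgebra.center ℝ L := by
  rw [LieModule.mem_maxTrivSubmodule] at hz ⊢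
  intro y
  have hy : J (J y) = -y := LinearMap.congr_fun hJ y
  rw [← neg_eq_zero, ← neg_lie, ← hy, hab, hz]

/-- for every `n ≥ 2` there is a `4n`-dimensional 2-step nilpotent real
Lie algebra admitting a hypersymplectic structure, none of whose hypersymplectic
structures has abelian complex structure or is of Kodaira type. -/
theorem stmt_17 :
    ∀ n : ℕ, 2 ≤ n →
      ∃ (L : Type) (iR : LieRing L) (iA : @LieAlgebra ℝ L _ iR)
        (iF : @FiniteDimensional ℝ L _ iR.toAddCommGroup iA.toModule),
        @GoodHSAlgebra n L iR iA iF := by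
  intro n hn
  obtain ⟨m, rfl⟩ := Nat.exists_eq_add_of_le' hn
  have invariant_false (J : Module.End ℝ (OddCenterAlgebra m)) (hJ : J ∘ₗ J = -1)
      (hinv : ∀ z ∈ LieAlgebra.center ℝ (OddCenterAlgebra m),
        J z ∈ LieAlgebra.center ℝ (OddCenterAlgebra m)) : False := by
    have heven := even_finrank_of_comp_self_eq_neg_one
      (J.restrict (p := (LieAlgebra.center ℝ (OddCenterAlgebra m)).toSubmodule) hinv)
      (LinearMap.ext fun z => Subtype.ext (LinearMap.congr_fun hJ z))
    have hodd : finrank ℝ (LieAlgebra.center ℝ (OddCenterAlgebra m)).toSubmodule = 4 * m + 5 :=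
      OddCenterAlgebra.finrank_center
    rw [hodd] at heven
    obtain ⟨k, hk⟩ := heven
    lia
  refine ⟨OddCenterAlgebra m, inferInstance, inferInstance, inferInstance,
    OddCenterAlgebra.finrank_eq, OddCenterAlgebra.lie_lie_eq_zero,
    OddCenterAlgebra.exists_lie_ne_zero, ⟨_, _, _, OddCenterAlgebra.isHypersymplectic⟩,
    fun g J E h => ?_, fun g J E h hK => invariant_false J h.1.2.2.1 hK.1⟩
  by_contra! hab
  exact invariant_false J h.1.2.2.1 fun z hz => map_mem_center_of_abelian h.1.2.2.1 hab hz
end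

section
/- Let 𝔤 and 𝔥 be finite-dimensional real Lie algebras equipped with nondegenerate symmetric bilinear forms g and h, let φ : 𝔥 → Der(𝔤) be a Lie algebra homomorphism, and equip 𝔤̃ = 𝔤 ⋊_φ 𝔥 with the product form g̃(X+A, Y+B) = g(X,Y) + h(A,B). Denote by ∇̃ and ∇ʰ the Levi-Civita connections of (𝔤̃, g̃) and (𝔥, h), and by R̃ and Rʰ their curvatures, R(u,v)w = ∇_u∇_v w - ∇_v∇_u w - ∇_{[u,v]}w. Then R̃(A, B)C = Rʰ(A, B)C for all A, B, C ∈ 𝔥. In particular, if Rʰ(A, B)C ≠ 0 for some A, B, C ∈ 𝔥, then g̃ is not flat. -/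
open Module

/-- for the product metric on a semidirect product `𝔤 ⋊_φ 𝔥`, the
curvature restricted to `𝔥` agrees with the curvature of `(𝔥, h)`; in particular if
`(𝔥, h)` is non-flat then so is the product metric. -/
theorem stmt_19
    (𝔤 𝔥 G : Type*)
    [LieRing 𝔤] [LieAlgebra ℝ 𝔤] [FiniteDimensional ℝ 𝔤]
    [LieRing 𝔥] [LieAlgebra ℝ 𝔥] [FiniteDimensional ℝ 𝔥]
    [LieRing G] [LieAlgebra ℝ G]
    (g : 𝔤 →ₗ[ℝ] 𝔤 →ₗ[ℝ] ℝ) (h : 𝔥 →ₗ[ℝ] 𝔥 →ₗ[ℝ] ℝ)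
    (gsymm : ∀ x y, g x y = g y x)
    (gnd : ∀ x, (∀ y, g x y = 0) → x = 0)
    (hsymm : ∀ a b, h a b = h b a)
    (hnd : ∀ a, (∀ b, h a b = 0) → a = 0)
    (φ : 𝔥 →ₗ[ℝ] Module.End ℝ 𝔤)
    (hder : ∀ a x y, φ a ⁅x, y⁆ = ⁅φ a x, y⁆ + ⁅x, φ a y⁆)
    (hhom : ∀ a b, φ ⁅a, b⁆ = φ a ∘ₗ φ b - φ b ∘ₗ φ a)
    -- G is the semidirect product 𝔤 ⋊_φ 𝔥, presented through i, p
    (i : 𝔤 →ₗ[ℝ] G) (p : 𝔥 →ₗ[ℝ] G)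
    (hbij : Function.Bijective fun q : 𝔤 × 𝔥 => i q.1 + p q.2)
    (hbrk : ∀ x a y b, ⁅i x + p a, i y + p b⁆
      = i ⁅x, y⁆ + i (φ a y) - i (φ b x) + p ⁅a, b⁆)
    -- the product metric g̃
    (gt : G →ₗ[ℝ] G →ₗ[ℝ] ℝ)
    (hgt : ∀ x a y b, gt (i x + p a) (i y + p b) = g x y + h a b)
    -- Levi-Civita connections of h and g̃
    (lch : 𝔥 →ₗ[ℝ] 𝔥 →ₗ[ℝ] 𝔥)
    (hlch : ∀ a b c, 2 * h (lch a b) c = h ⁅a, b⁆ c - h b ⁅a, c⁆ - h a ⁅b, c⁆)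
    (lct : G →ₗ[ℝ] G →ₗ[ℝ] G)
    (hlct : ∀ u v w, 2 * gt (lct u v) w = gt ⁅u, v⁆ w - gt v ⁅u, w⁆ - gt u ⁅v, w⁆) :
    (∀ A B C : 𝔥,
        lct (p A) (lct (p B) (p C)) - lct (p B) (lct (p A) (p C)) - lct ⁅p A, p B⁆ (p C)
        = p (lch A (lch B C) - lch B (lch A C) - lch ⁅A, B⁆ C))
    ∧ ((∃ A B C : 𝔥, lch A (lch B C) - lch B (lch A C) - lch ⁅A, B⁆ C ≠ 0) →
        ∃ u v w : G, lct u (lct v w) - lct v (lct u w) - lct ⁅u, v⁆ w ≠ 0) := by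
  have gt_nondeg : ∀ u, (∀ w, gt u w = 0) → u = 0 := by
    intro u hu
    obtain ⟨⟨x, a⟩, rfl⟩ := hbij.surjective u
    have hx : x = 0 := gnd x fun y => by
      simpa using (hgt x a y 0).symm.trans (hu _)
    have ha : a = 0 := hnd a fun b => by
      simpa using (hgt x a 0 b).symm.trans (hu _)
    simp [hx, ha]
  have gt_p : ∀ a y b, gt (p a) (i y + p b) = h a b := fun a y b => by
    simpa using hgt 0 a y b
  have lie_p : ∀ a y b, ⁅p a, i y + p b⁆ = i (φ a y) + p ⁅a, b⁆ := fun a y b => by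
    simpa using hbrk 0 a y b
  have lie_pp : ∀ a b, ⁅p a, p b⁆ = p ⁅a, b⁆ := fun a b => by
    simpa using lie_p a 0 b
  have lct_p : ∀ a b, lct (p a) (p b) = p (lch a b) := by
    intro a b
    refine sub_eq_zero.mp (gt_nondeg _ fun w => ?_)
    obtain ⟨⟨z, c⟩, rfl⟩ := hbij.surjective w
    have key := hlct (p a) (p b) (i z + p c)
    rw [lie_p, lie_p, lie_pp, gt_p, gt_p, gt_p] at key
    simp only [map_sub, LinearMap.sub_apply, gt_p]
    linarith [hlch a b c]
  have p_inj : ∀ a, p a = 0 → a = 0 := by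
    intro a ha
    have := @hbij.1 (0, a) (0, 0) (by simp [ha])
    simpa using this
  have curv : ∀ A B C : 𝔥,
      lct (p A) (lct (p B) (p C)) - lct (p B) (lct (p A) (p C)) - lct ⁅p A, p B⁆ (p C)
        = p (lch A (lch B C) - lch B (lch A C) - lch ⁅A, B⁆ C) := by
    intro A B C
    simp only [lct_p, lie_pp, map_sub]
  refine ⟨curv, ?_⟩
  rintro ⟨A, B, C, hne⟩
  refine ⟨p A, p B, p C, fun h0 => hne (p_inj _ ?_)⟩
  rw [← curv, h0]
end
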